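/- Subject expansion for β in ⊢2: if N : ⟨Γ ⊢2 U⟩ is derivable, M ∈ 𝓜 and M ▷β* N, then M : ⟨Γ ⊢2 U⟩ is derivable. -/

import Mathlib

/-! Common development: the indexed λI-calculus (the λI^ℕ-calculus), types with
expansion variables, the realisability semantics, and the typing systems ⊢1 and ⊢2. -/

/-- The set of variables 𝓥, split as the disjoint union of two denumerably
infinite sets 𝓥₁ (`Sum.inl`) and 𝓥₂ (`Sum.inr`). -/
abbrev Vr : Type := ℕ ⊕ ℕ

/-- Raw terms of the λI^ℕ-calculus: every variable occurrence carries a degree. -/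
inductive Trm : Type
  | var : Vr → ℕ → Trm
  | app : Trm → Trm → Trm
  | lam : Vr → ℕ → Trm → Trm
  deriving DecidableEq

namespace Trm

/-- Free indexed variables `FV M`. -/
def FV : Trm → Set (Vr × ℕ)
  | var x n => {(x, n)}
  | app M N => FV M ∪ FV N
  | lam x n M => FV M \ {(x, n)}

/-- Names that are λ-bound somewhere in the term. -/
def BV : Trm → Set Vr
  | var _ _ => ∅
  | app M N => BV M ∪ BV N
  | lam x _ M => insert x (BV M)

/-- Degree `d(M)` of a term. -/
def deg : Trm → ℕ
  | var _ n => n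
  | app M N => min (deg M) (deg N)
  | lam _ _ M => deg M

/-- Joinability `M ◇ N`: any variable free in both occurs with the same degree. -/
def Joinable (M N : Trm) : Prop :=
  ∀ x m n, (x, m) ∈ FV M → (x, n) ∈ FV N → m = n

/-- Membership in the set 𝓜 of terms (λI-condition and joinability at applications). -/
inductive InM : Trm → Prop
  | var (x : Vr) (n : ℕ) : InM (Trm.var x n)
  | app {M N : Trm} : InM M → InM N → Joinable M N → InM (Trm.app M N)
  | lam {M : Trm} {x : Vr} {n : ℕ} : InM M → (x, n) ∈ FV M → InM (Trm.lam x n M)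

/-- The good terms 𝕄: the degree of a function is never larger than that of
its argument. -/
inductive Good : Trm → Prop
  | var (x : Vr) (n : ℕ) : Good (Trm.var x n)
  | app {M N : Trm} : Good M → Good N → Joinable M N → deg M ≤ deg N →
      Good (Trm.app M N)
  | lam {M : Trm} {x : Vr} {n : ℕ} : Good M → (x, n) ∈ FV M → Good (Trm.lam x n M)

/-- Substitution of `N` for `x^n` (capture is excluded by side conditions on its
uses, following the Barendregt convention). -/
def subst (x : Vr) (n : ℕ) (N : Trm) : Trm → Trm
  | var y m => if y = x ∧ m = n then N else var y m
  | app P Q => app (subst x n N P) (subst x n N Q)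
  | lam y m P => if y = x ∧ m = n then lam y m P else lam y m (subst x n N P)

/-- `M⁺`: raise every degree index by one. -/
def lift : Trm → Trm
  | var x n => var x (n + 1)
  | app M N => app (lift M) (lift N)
  | lam x n M => lam x (n + 1) (lift M)

/-- One-step β-reduction `▷β`: the least compatible relation closed under the
rule `(λx^n.M)N ▷β M[x^n := N]` when `d(N) = n` (the λI-condition `x^n ∈ FV M`
and the absence of capture come from working with terms of 𝓜 modulo α under
the Barendregt convention). -/
inductive Beta : Trm → Trm → Prop
  | redex {x : Vr} {n : ℕ} {M N : Trm} :
      (x, n) ∈ FV M → deg N = n →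
      (∀ y m, (y, m) ∈ FV N → y ∉ BV M) →
      Beta (Trm.app (Trm.lam x n M) N) (subst x n N M)
  | lam {M N : Trm} {x : Vr} {n : ℕ} :
      Beta M N → (x, n) ∈ FV M → (x, n) ∈ FV N →
      Beta (Trm.lam x n M) (Trm.lam x n N)
  | appL {M N P : Trm} :
      Beta M N → Joinable M P → Joinable N P →
      Beta (Trm.app M P) (Trm.app N P)
  | appR {M N P : Trm} :
      Beta M N → Joinable P M → Joinable P N →
      Beta (Trm.app P M) (Trm.app P N)

/-- `▷β*`: the reflexive transitive closure of `▷β`. -/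
def Betas : Trm → Trm → Prop := Relation.ReflTransGen Beta

end Trm

/-- `𝕄ⁿ`: the good terms of degree `n`. -/
def Mdeg (n : ℕ) : Set Trm := {M | Trm.Good M ∧ Trm.deg M = n}

/-- A set of terms is saturated iff it is closed under β-expansion. -/
def Saturated (X : Set Trm) : Prop := ∀ M N, Trm.Betas M N → N ∈ X → M ∈ X

/-- `X ⤳ Y`. -/
def ArrSet (X Y : Set Trm) : Set Trm :=
  {M | ∀ N ∈ X, Trm.Joinable M N → Trm.app M N ∈ Y}

/-- `𝓝ₓⁿ = {x^n N₁ … N_k ∈ 𝕄 ∣ k ≥ 0}` for `x ∈ 𝓥₁`. -/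
def NSet (x n : ℕ) : Set Trm :=
  {M | Trm.Good M ∧ ∃ l : List Trm, M = l.foldl Trm.app (Trm.var (Sum.inl x) n)}

/-- Types over the denumerable set ℕ of atomic types and a set `E` of expansion
variables. -/
inductive Ty (E : Type) : Type
  | atom : ℕ → Ty E
  | arr : Ty E → Ty E → Ty E
  | inter : Ty E → Ty E → Ty E
  | exp : E → Ty E → Ty E

namespace Ty

variable {E : Type}

/-- Degree `d(U)` of a type. -/
def deg : Ty E → ℕ
  | atom _ => 0
  | arr U T => min (deg U) (deg T)
  | inter U V => min (deg U) (deg V)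
  | exp _ U => deg U + 1

/-- Good types. -/
inductive GoodTy : Ty E → Prop
  | atom (a : ℕ) : GoodTy (Ty.atom a)
  | exp {U : Ty E} (e : E) : GoodTy U → GoodTy (Ty.exp e U)
  | arr {U T : Ty E} : GoodTy U → GoodTy T → deg T ≤ deg U → GoodTy (Ty.arr U T)
  | inter {U V : Ty E} : GoodTy U → GoodTy V → deg U = deg V → GoodTy (Ty.inter U V)

mutual
  /-- The restricted types 𝕋 (no arrow on the left of ⊓ or of an expansion). -/
  inductive IsT : Ty E → Prop
    | atom (a : ℕ) : IsT (Ty.atom a)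
    | arr {U T : Ty E} : IsU U → IsT T → IsT (Ty.arr U T)
  /-- The restricted types 𝕌. -/
  inductive IsU : Ty E → Prop
    | ofT {T : Ty E} : IsT T → IsU T
    | inter {U V : Ty E} : IsU U → IsU V → IsU (Ty.inter U V)
    | exp {U : Ty E} (e : E) : IsU U → IsU (Ty.exp e U)
end

/-- Equality of types induced by the quotient (⊓ commutative, associative,
idempotent, and `e(U₁ ⊓ U₂) = eU₁ ⊓ eU₂`), as a congruence. -/
inductive TEq : Ty E → Ty E → Prop
  | refl (U : Ty E) : TEq U U
  | symm {U V : Ty E} : TEq U V → TEq V U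
  | trans {U V W : Ty E} : TEq U V → TEq V W → TEq U W
  | comm (U V : Ty E) : TEq (Ty.inter U V) (Ty.inter V U)
  | assoc (U V W : Ty E) : TEq (Ty.inter (Ty.inter U V) W) (Ty.inter U (Ty.inter V W))
  | idem (U : Ty E) : TEq (Ty.inter U U) U
  | dist (e : E) (U V : Ty E) :
      TEq (Ty.exp e (Ty.inter U V)) (Ty.inter (Ty.exp e U) (Ty.exp e V))
  | arrCongr {U U' T T' : Ty E} : TEq U U' → TEq T T' → TEq (Ty.arr U T) (Ty.arr U' T')
  | interCongr {U U' V V' : Ty E} : TEq U U' → TEq V V' →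
      TEq (Ty.inter U V) (Ty.inter U' V')
  | expCongr (e : E) {U U' : Ty E} : TEq U U' → TEq (Ty.exp e U) (Ty.exp e U')

/-- The degree-decreasing operation `U⁻` (meaningful when `d(U) > 0`). -/
def tmin : Ty E → Ty E
  | exp _ U => U
  | inter U V => inter (tmin U) (tmin V)
  | atom a => atom a
  | arr U T => arr U T

/-- The subtyping relation ⊑ on 𝕌.  It contains the quotient equality `TEq`,
which makes it reflexive on equivalence classes of types. -/
inductive TSub : Ty E → Ty E → Prop
  | ofEq {U V : Ty E} : TEq U V → TSub U V
  | trans {U V W : Ty E} : TSub U V → TSub V W → TSub U W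
  | interElim {U₁ U₂ : Ty E} : GoodTy U₂ → deg U₁ = deg U₂ →
      TSub (Ty.inter U₁ U₂) U₁
  | interCongr {U₁ U₂ V₁ V₂ : Ty E} : TSub U₁ V₁ → TSub U₂ V₂ →
      TSub (Ty.inter U₁ U₂) (Ty.inter V₁ V₂)
  | arr {U₁ U₂ T₁ T₂ : Ty E} : TSub U₂ U₁ → TSub T₁ T₂ →
      TSub (Ty.arr U₁ T₁) (Ty.arr U₂ T₂)
  | expCongr (e : E) {U V : Ty E} : TSub U V → TSub (Ty.exp e U) (Ty.exp e V)

end Ty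

/-- Type environments: finite maps from indexed variables to types. -/
abbrev Env (E : Type) : Type := Vr × ℕ → Option (Ty E)

namespace Env

variable {E : Type}

/-- The empty environment `()`. -/
def empty : Env E := fun _ => none

def dom (Γ : Env E) : Set (Vr × ℕ) := {p | Γ p ≠ none}

/-- The singleton environment `(x^n : U)`. -/
def single (p : Vr × ℕ) (U : Ty E) : Env E := fun q => if q = p then some U else none

/-- The extension `Γ, (x^n : U)`. -/
def update (Γ : Env E) (p : Vr × ℕ) (U : Ty E) : Env E :=
  fun q => if q = p then some U else Γ q

/-- Joinability `Γ₁ ◇ Γ₂` of environments. -/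
def Joinable (Γ₁ Γ₂ : Env E) : Prop :=
  ∀ x m n, (x, m) ∈ dom Γ₁ → (x, n) ∈ dom Γ₂ → m = n

/-- `Γ₁ ⊓ Γ₂`. -/
def inter (Γ₁ Γ₂ : Env E) : Env E := fun p =>
  match Γ₁ p, Γ₂ p with
  | some U, some V => some (Ty.inter U V)
  | some U, none => some U
  | none, o => o

/-- `eΓ`: apply `e` to every type of `Γ` and raise every variable index by one. -/
def eexp (e : E) (Γ : Env E) : Env E := fun p =>
  match p with
  | (_, 0) => none
  | (x, n + 1) => (Γ (x, n)).map (Ty.exp e)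

/-- A good environment. -/
def Good (Γ : Env E) : Prop := ∀ p U, Γ p = some U → Ty.GoodTy U

/-- Environments equal up to the quotient equality on types. -/
def EqT (Γ Γ' : Env E) : Prop :=
  (∀ p, Γ p = none ↔ Γ' p = none) ∧
  ∀ p U U', Γ p = some U → Γ' p = some U' → Ty.TEq U U'

/-- Pointwise subtyping of environments (with the same domain). -/
def LE (Γ Γ' : Env E) : Prop :=
  (∀ p, Γ p = none ↔ Γ' p = none) ∧
  ∀ p U U', Γ p = some U → Γ' p = some U' → Ty.TSub U U'

end Env

/-- The typing system ⊢1 (types range over the full set 𝓣). -/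
inductive Der1 {E : Type} : Trm → Env E → Ty E → Prop
  | ax (x : Vr) (n : ℕ) {T : Ty E} : Ty.GoodTy T → Ty.deg T = n →
      Der1 (Trm.var x n) (Env.single (x, n) T) T
  | arrI {Γ : Env E} {x : Vr} {n : ℕ} {M : Trm} {U T : Ty E} :
      Γ (x, n) = none → Der1 M (Env.update Γ (x, n) U) T →
      Der1 (Trm.lam x n M) Γ (Ty.arr U T)
  | arrE {Γ₁ Γ₂ : Env E} {M₁ M₂ : Trm} {U T : Ty E} :
      Der1 M₁ Γ₁ (Ty.arr U T) → Der1 M₂ Γ₂ U → Env.Joinable Γ₁ Γ₂ →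
      Der1 (Trm.app M₁ M₂) (Env.inter Γ₁ Γ₂) T
  | inter {Γ₁ Γ₂ : Env E} {M : Trm} {U₁ U₂ : Ty E} :
      Der1 M Γ₁ U₁ → Der1 M Γ₂ U₂ →
      Der1 M (Env.inter Γ₁ Γ₂) (Ty.inter U₁ U₂)
  | exp (e : E) {Γ : Env E} {M : Trm} {U : Ty E} :
      Der1 M Γ U → Der1 (Trm.lift M) (Env.eexp e Γ) (Ty.exp e U)
  | eq {Γ Γ' : Env E} {M : Trm} {U U' : Ty E} :
      Der1 M Γ U → Env.EqT Γ Γ' → Ty.TEq U U' → Der1 M Γ' U'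

/-- The typing system ⊢2 (types range over 𝕌, with `T` ranging over 𝕋),
with the subsumption rule for ⊑. -/
inductive Der2 {E : Type} : Trm → Env E → Ty E → Prop
  | ax (x : Vr) {T : Ty E} : Ty.IsT T → Ty.GoodTy T →
      Der2 (Trm.var x 0) (Env.single (x, 0) T) T
  | arrI {Γ : Env E} {x : Vr} {n : ℕ} {M : Trm} {U T : Ty E} :
      Ty.IsU U → Ty.IsT T →
      Γ (x, n) = none → Der2 M (Env.update Γ (x, n) U) T →
      Der2 (Trm.lam x n M) Γ (Ty.arr U T)
  | arrE {Γ₁ Γ₂ : Env E} {M₁ M₂ : Trm} {U T : Ty E} :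
      Ty.IsU U → Ty.IsT T →
      Der2 M₁ Γ₁ (Ty.arr U T) → Der2 M₂ Γ₂ U → Env.Joinable Γ₁ Γ₂ →
      Der2 (Trm.app M₁ M₂) (Env.inter Γ₁ Γ₂) T
  | inter {Γ₁ Γ₂ : Env E} {M : Trm} {U₁ U₂ : Ty E} :
      Der2 M Γ₁ U₁ → Der2 M Γ₂ U₂ →
      Der2 M (Env.inter Γ₁ Γ₂) (Ty.inter U₁ U₂)
  | exp (e : E) {Γ : Env E} {M : Trm} {U : Ty E} :
      Der2 M Γ U → Der2 (Trm.lift M) (Env.eexp e Γ) (Ty.exp e U)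
  | sub {Γ Γ' : Env E} {M : Trm} {U U' : Ty E} :
      Der2 M Γ U → Ty.TSub U U' → Env.LE Γ' Γ → Der2 M Γ' U'

/-- An interpretation `𝓘 : 𝓐 → 𝓟(𝓜⁰)`: each `𝓘(a)` is saturated and
`𝓝ₓ⁰ ⊆ 𝓘(a) ⊆ 𝕄⁰` for every `x ∈ 𝓥₁`. -/
def IsInterp (I : ℕ → Set Trm) : Prop :=
  ∀ a : ℕ, Saturated (I a) ∧ (∀ x : ℕ, NSet x 0 ⊆ I a) ∧ I a ⊆ Mdeg 0

/-- The extension of an interpretation to all types: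
`𝓘(eU) = 𝓘(U)⁺`, `𝓘(U ⊓ V) = 𝓘(U) ∩ 𝓘(V)`, `𝓘(U → T) = 𝓘(U) ⤳ 𝓘(T)`. -/
def IntExt {E : Type} (I : ℕ → Set Trm) : Ty E → Set Trm
  | Ty.atom a => I a
  | Ty.arr U T => ArrSet (IntExt I U) (IntExt I T)
  | Ty.inter U V => IntExt I U ∩ IntExt I V
  | Ty.exp _ U => Trm.lift '' IntExt I U

/-- The meaning `[U]` of a type: the closed terms belonging to `𝓘(U)` for
every interpretation `𝓘`. -/
def Mean {E : Type} (U : Ty E) : Set Trm :=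
  {M | Trm.InM M ∧ Trm.FV M = ∅ ∧ ∀ I : ℕ → Set Trm, IsInterp I → M ∈ IntExt I U}

/-- Simultaneous substitution along a finite assignment `σ`. -/
def msubst (σ : Vr × ℕ → Option Trm) : Trm → Trm
  | Trm.var x n => (σ (x, n)).getD (Trm.var x n)
  | Trm.app M N => Trm.app (msubst σ M) (msubst σ N)
  | Trm.lam x n M => Trm.lam x n (msubst (fun p => if p = (x, n) then none else σ p) M)

/-- The simultaneous substitution `M[(xⱼ^{nⱼ} := Nⱼ)ⱼ]` is defined: the set
`{M} ∪ {Nⱼ ∣ j}` is pairwise joinable and (Barendregt convention) no capture occurs. -/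
def SubstDefined (σ : Vr × ℕ → Option Trm) (M : Trm) : Prop :=
  (∀ p N, σ p = some N → Trm.Joinable M N) ∧
  (∀ p q N N', σ p = some N → σ q = some N' → Trm.Joinable N N') ∧
  (∀ p N y m, σ p = some N → (y, m) ∈ Trm.FV N → y ∉ Trm.BV M)

namespace Ty

variable {E : Type}

theorem TEq.interComm₄ (a b c d : Ty E) :
    TEq (inter (inter a b) (inter c d)) (inter (inter a c) (inter b d)) := by
  refine (TEq.assoc _ _ _).trans (.trans (.interCongr (.refl _) ?_) (TEq.assoc _ _ _).symm)
  exact (TEq.assoc _ _ _).symm.trans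
    (.trans (.interCongr (.comm _ _) (.refl _)) (TEq.assoc _ _ _))

theorem TEq.rightComm (a b c : Ty E) :
    TEq (inter (inter a b) c) (inter (inter a c) b) :=
  (TEq.assoc _ _ _).trans (.trans (.interCongr (.refl _) (.comm _ _)) (TEq.assoc _ _ _).symm)

theorem TEq.leftComm (a b c : Ty E) :
    TEq (inter a (inter b c)) (inter b (inter a c)) :=
  (TEq.assoc _ _ _).symm.trans (.trans (.interCongr (.comm _ _) (.refl _)) (TEq.assoc _ _ _))

theorem IsT.deg_eq_zero : ∀ {T : Ty E}, IsT T → deg T = 0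
  | _, .atom _ => rfl
  | _, .arr _ hT => by simp [deg, hT.deg_eq_zero]

theorem goodTy_exp {e : E} {U : Ty E} : GoodTy (exp e U) ↔ GoodTy U :=
  ⟨fun | .exp _ h => h, .exp e⟩

theorem goodTy_arr {U T : Ty E} :
    GoodTy (arr U T) ↔ GoodTy U ∧ GoodTy T ∧ deg T ≤ deg U :=
  ⟨fun | .arr h₁ h₂ h₃ => ⟨h₁, h₂, h₃⟩, fun h => .arr h.1 h.2.1 h.2.2⟩

theorem goodTy_inter {U V : Ty E} :
    GoodTy (inter U V) ↔ GoodTy U ∧ GoodTy V ∧ deg U = deg V :=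
  ⟨fun | .inter h₁ h₂ h₃ => ⟨h₁, h₂, h₃⟩, fun h => .inter h.1 h.2.1 h.2.2⟩

theorem TEq.deg_eq_and_good_iff {U V : Ty E} (h : TEq U V) :
    deg U = deg V ∧ (GoodTy U ↔ GoodTy V) := by
  induction h <;> grind [deg, goodTy_exp, goodTy_arr, goodTy_inter]

theorem TSub.deg_eq_and_good_iff {U V : Ty E} (h : TSub U V) :
    deg U = deg V ∧ (GoodTy U ↔ GoodTy V) := by
  induction h with
  | ofEq h => exact h.deg_eq_and_good_iff
  | _ => grind [deg, goodTy_exp, goodTy_arr, goodTy_inter]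

end Ty

namespace Env

variable {E : Type}

theorem le_refl (Γ : Env E) : LE Γ Γ := by
  refine ⟨fun _ => Iff.rfl, fun p U U' h h' => ?_⟩
  obtain rfl : U = U' := by simpa [h] using h'
  exact .ofEq (.refl _)

theorem le_trans {Γ₁ Γ₂ Γ₃ : Env E} (h : LE Γ₁ Γ₂) (h' : LE Γ₂ Γ₃) : LE Γ₁ Γ₃ := by
  refine ⟨fun p => (h.1 p).trans (h'.1 p), fun p U W hU hW => ?_⟩
  cases hV : Γ₂ p with
  | none => simp [(h.1 p).2 hV] at hU
  | some V => exact (h.2 p U V hU hV).trans (h'.2 p V W hV hW)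

theorem inter_eq_none {Γ₁ Γ₂ : Env E} {p : Vr × ℕ} :
    inter Γ₁ Γ₂ p = none ↔ Γ₁ p = none ∧ Γ₂ p = none := by
  unfold inter
  cases Γ₁ p <;> cases Γ₂ p <;> simp

theorem inter_le_inter {Γ₁ Γ₂ Δ₁ Δ₂ : Env E} (h₁ : LE Γ₁ Δ₁) (h₂ : LE Γ₂ Δ₂) :
    LE (inter Γ₁ Γ₂) (inter Δ₁ Δ₂) := by
  refine ⟨fun p => by rw [inter_eq_none, inter_eq_none, h₁.1, h₂.1], fun p U V => ?_⟩
  have a₁ := h₁.1 p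
  have a₂ := h₂.1 p
  have b₁ := h₁.2 p
  have b₂ := h₂.2 p
  unfold inter
  cases h1 : Γ₁ p <;> cases h2 : Γ₂ p <;> cases h3 : Δ₁ p <;> cases h4 : Δ₂ p <;>
    simp only [h1, h2, h3, h4, reduceCtorEq, Option.some.injEq, true_iff, iff_true,
      false_implies] at a₁ a₂ b₁ b₂ ⊢ <;>
    rintro rfl rfl
  · exact b₂ _ _ rfl rfl
  · exact b₁ _ _ rfl rfl
  · exact .interCongr (b₁ _ _ rfl rfl) (b₂ _ _ rfl rfl)

theorem inter_inter_inter_le (A B C D : Env E) :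
    LE (inter (inter A B) (inter C D)) (inter (inter A C) (inter B D)) := by
  refine ⟨fun p => by simp only [inter_eq_none]; tauto, fun p U V => ?_⟩
  unfold inter
  cases A p <;> cases B p <;> cases C p <;> cases D p <;>
    (simp only [reduceCtorEq, Option.some.injEq, false_implies]; try (rintro rfl rfl))
  all_goals first
    | exact .ofEq (.refl _)
    | exact .ofEq (.comm _ _)
    | exact .ofEq (.interComm₄ _ _ _ _)
    | exact .ofEq (.assoc _ _ _)
    | exact .ofEq (Ty.TEq.assoc _ _ _).symm
    | exact .ofEq (.rightComm _ _ _)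
    | exact .ofEq (.leftComm _ _ _)

@[simp] theorem inter_empty (Γ : Env E) : inter Γ empty = Γ := by
  funext p
  unfold inter empty
  cases Γ p <;> rfl

@[simp] theorem empty_inter (Γ : Env E) : inter empty Γ = Γ := rfl

theorem eexp_inter_le (e : E) (Γ₁ Γ₂ : Env E) :
    LE (eexp e (inter Γ₁ Γ₂)) (inter (eexp e Γ₁) (eexp e Γ₂)) := by
  refine ⟨?_, ?_⟩
  · rintro ⟨x, _ | n⟩
    · simp [inter_eq_none, eexp]
    · simp [inter_eq_none, eexp]
  · rintro ⟨x, _ | n⟩ U V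
    · simp [eexp]
    · simp only [eexp, inter]
      cases Γ₁ (x, n) <;> cases Γ₂ (x, n) <;>
        simp only [Option.map_some, Option.map_none, reduceCtorEq, Option.some.injEq,
          false_implies] <;> (try (rintro rfl rfl))
      · exact .ofEq (.refl _)
      · exact .ofEq (.refl _)
      · exact .ofEq (.dist _ _ _)

theorem eexp_le_eexp (e : E) {Γ Δ : Env E} (h : LE Γ Δ) : LE (eexp e Γ) (eexp e Δ) := by
  refine ⟨?_, ?_⟩
  · rintro ⟨x, _ | n⟩
    · simp [eexp]
    · simp [eexp, h.1]
  · rintro ⟨x, _ | n⟩ U V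
    · simp [eexp]
    · simp only [eexp, Option.map_eq_some_iff]
      rintro ⟨U, hU, rfl⟩ ⟨V, hV, rfl⟩
      exact .expCongr e (h.2 _ _ _ hU hV)

theorem eexp_update (e : E) (Γ : Env E) (x : Vr) (n : ℕ) (U : Ty E) :
    eexp e (update Γ (x, n) U) = update (eexp e Γ) (x, n + 1) (Ty.exp e U) := by
  funext ⟨y, k⟩
  cases k with
  | zero => simp [eexp, update]
  | succ k =>
    simp only [eexp, update, Prod.mk.injEq, Nat.add_right_cancel_iff]
    split <;> rfl

theorem update_inter_update (Γ Δ : Env E) (p : Vr × ℕ) (U V : Ty E) :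
    inter (update Γ p U) (update Δ p V) = update (inter Γ Δ) p (Ty.inter U V) := by
  funext q
  simp only [inter, update]
  split_ifs <;> rfl

theorem update_inter (Γ : Env E) {Δ : Env E} {p : Vr × ℕ} (U : Ty E) (h : Δ p = none) :
    inter (update Γ p U) Δ = update (inter Γ Δ) p U := by
  funext q
  simp only [inter, update]
  split_ifs with hq
  · subst hq
    rw [h]
  · rfl

theorem inter_update {Γ : Env E} (Δ : Env E) {p : Vr × ℕ} (U : Ty E) (h : Γ p = none) :
    inter Γ (update Δ p U) = update (inter Γ Δ) p U := by
  funext q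
  simp only [inter, update]
  split_ifs with hq
  · subst hq
    rw [h]
  · rfl

end Env

namespace Trm

theorem mem_FV_lift {M : Trm} {x : Vr} {n : ℕ} :
    (x, n + 1) ∈ FV (lift M) ↔ (x, n) ∈ FV M := by
  induction M <;> simp_all [FV, lift]

theorem not_mem_FV_lift_zero {M : Trm} {x : Vr} : (x, 0) ∉ FV (lift M) := by
  induction M <;> simp_all [FV, lift]

theorem BV_lift (M : Trm) : BV (lift M) = BV M := by
  induction M <;> simp_all [BV, lift]

theorem deg_lift (M : Trm) : deg (lift M) = deg M + 1 := by
  induction M <;> simp_all [deg, lift]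

theorem joinable_lift {M N : Trm} : Joinable (lift M) (lift N) ↔ Joinable M N := by
  constructor
  · intro h x m n hm hn
    simpa using h x (m + 1) (n + 1) (mem_FV_lift.2 hm) (mem_FV_lift.2 hn)
  · rintro h x (_ | m) (_ | n) hm hn
    · rfl
    · exact (not_mem_FV_lift_zero hm).elim
    · exact (not_mem_FV_lift_zero hn).elim
    · rw [h x m n (mem_FV_lift.1 hm) (mem_FV_lift.1 hn)]

theorem inM_app {M N : Trm} : InM (app M N) ↔ InM M ∧ InM N ∧ Joinable M N :=
  ⟨fun | .app h₁ h₂ h₃ => ⟨h₁, h₂, h₃⟩, fun h => .app h.1 h.2.1 h.2.2⟩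

theorem inM_lam {M : Trm} {x : Vr} {n : ℕ} : InM (lam x n M) ↔ InM M ∧ (x, n) ∈ FV M :=
  ⟨fun | .lam h₁ h₂ => ⟨h₁, h₂⟩, fun h => .lam h.1 h.2⟩

theorem inM_lift {M : Trm} : InM (lift M) ↔ InM M := by
  induction M with
  | var x n => exact ⟨fun _ => .var _ _, fun _ => .var _ _⟩
  | app M N ihM ihN => rw [lift, inM_app, inM_app, ihM, ihN, joinable_lift]
  | lam x n M ih => rw [lift, inM_lam, inM_lam, ih, mem_FV_lift]

theorem lift_injective : Function.Injective lift := by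
  intro M
  induction M with
  | var x n => intro N h; cases N <;> simp_all [lift]
  | app M₁ M₂ ih₁ ih₂ =>
    intro N h
    cases N <;> simp only [lift, app.injEq, reduceCtorEq] at h
    rw [ih₁ h.1, ih₂ h.2]
  | lam x n M ih =>
    intro N h
    cases N <;> simp only [lift, lam.injEq, reduceCtorEq, Nat.add_right_cancel_iff] at h
    rw [h.1, h.2.1, ih h.2.2]

theorem lift_eq_app {R P Q : Trm} (h : lift R = app P Q) :
    ∃ P' Q', R = app P' Q' ∧ lift P' = P ∧ lift Q' = Q := by
  cases R <;> simp_all [lift]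

theorem lift_eq_lam {R P : Trm} {x : Vr} {n : ℕ} (h : lift R = lam x n P) :
    ∃ k P', R = lam x k P' ∧ n = k + 1 ∧ lift P' = P := by
  cases R <;> simp_all [lift]

theorem lift_eq_var {R : Trm} {x : Vr} {n : ℕ} (h : lift R = var x n) :
    ∃ k, R = var x k ∧ n = k + 1 := by
  cases R <;> simp_all [lift]

theorem subst_eq_self {x : Vr} {n : ℕ} {N M : Trm} (h : (x, n) ∉ FV M) :
    subst x n N M = M := by
  induction M <;> grind [subst, FV]

theorem FV_subst {x : Vr} {n : ℕ} {N M : Trm}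
    (hc : ∀ y m, (y, m) ∈ FV N → y ∉ BV M) (p : Vr × ℕ) :
    p ∈ FV (subst x n N M) ↔
      (p ∈ FV M ∧ p ≠ (x, n)) ∨ ((x, n) ∈ FV M ∧ p ∈ FV N) := by
  induction M with
  | var y m => grind [subst, FV]
  | app P Q ihP ihQ => grind [subst, FV, BV]
  | lam y m P ih =>
    obtain ⟨z, k⟩ := p
    have ih := ih fun z k hz => by grind [BV]
    have := hc y m
    grind [subst, FV, BV]

theorem inM_subst {x : Vr} {n : ℕ} {N M : Trm} (hM : InM M) (hN : InM N)
    (hc : ∀ y m, (y, m) ∈ FV N → y ∉ BV M)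
    (hj : ∀ y m k, (y, m) ∈ FV M → (y, m) ≠ (x, n) → (y, k) ∈ FV N → m = k) :
    InM (subst x n N M) := by
  induction M with
  | var y m =>
    rw [subst]
    split
    · exact hN
    · exact hM
  | app P Q ihP ihQ =>
    obtain ⟨hP, hQ, hPQ⟩ := inM_app.1 hM
    have cP : ∀ y m, (y, m) ∈ FV N → y ∉ BV P := by grind [BV]
    have cQ : ∀ y m, (y, m) ∈ FV N → y ∉ BV Q := by grind [BV]
    refine .app (ihP hP cP ?_) (ihQ hQ cQ ?_) ?_
    · grind [FV]
    · grind [FV]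
    · have key : ∀ y a b, (y, a) ∈ FV N → (y, b) ∈ FV N → a = b := by
        clear * - hN
        induction hN <;> grind [FV, Joinable]
      intro y a b ha hb
      rw [FV_subst cP] at ha
      rw [FV_subst cQ] at hb
      have := hPQ y a b
      have := key y a b
      grind [FV]
  | lam y m P ih =>
    obtain ⟨hP, hy⟩ := inM_lam.1 hM
    have cP : ∀ y m, (y, m) ∈ FV N → y ∉ BV P := by grind [BV]
    rw [subst]
    split
    · exact hM
    · refine .lam (ih hP cP ?_) ?_
      · grind [FV, BV]
      · rw [FV_subst cP]
        grind

theorem Beta.FV_eq {M N : Trm} (h : Beta M N) : FV N = FV M := by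
  induction h with
  | redex hx hd hc =>
    ext p
    rw [FV_subst hc]
    simp [FV, hx]
  | _ => simp_all [FV]

theorem Beta.inM {M N : Trm} (h : Beta M N) (hM : InM M) : InM N := by
  induction h with
  | redex hx hd hc =>
    obtain ⟨h₁, h₂, h₃⟩ := inM_app.1 hM
    refine inM_subst (inM_lam.1 h₁).1 h₂ hc fun y m k hm hne hk => h₃ y m k ?_ hk
    exact ⟨hm, hne⟩
  | lam _ _ hx ih => exact .lam (ih (inM_lam.1 hM).1) hx
  | appL _ _ hj ih => exact .app (ih (inM_app.1 hM).1) (inM_app.1 hM).2.1 hj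
  | appR _ _ hj ih => exact .app (inM_app.1 hM).1 (ih (inM_app.1 hM).2.1) hj

theorem exists_eq_lift_of_subst_eq_lift {x : Vr} {n : ℕ} {Q P R : Trm} (hx : (x, n) ∈ FV P)
    (h : subst x n Q P = lift R) : ∃ Q', Q = lift Q' := by
  induction P generalizing R with
  | var y m =>
    obtain ⟨rfl, rfl⟩ : x = y ∧ n = m := by simpa [FV] using hx
    exact ⟨R, by simpa [subst] using h⟩
  | app P₁ P₂ ih₁ ih₂ =>
    obtain ⟨R₁, R₂, rfl, h₁, h₂⟩ := lift_eq_app h.symm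
    rcases hx with hx | hx
    · exact ih₁ hx h₁.symm
    · exact ih₂ hx h₂.symm
  | lam y m P ih =>
    have hne : ¬ (y = x ∧ m = n) := fun ⟨h₁, h₂⟩ => hx.2 (by simp [h₁, h₂])
    rw [subst, if_neg hne] at h
    obtain ⟨k, R', rfl, rfl, h'⟩ := lift_eq_lam h.symm
    exact ih hx.1 h'.symm

theorem exists_eq_lift_of_subst_lift_eq_lift {x : Vr} {n : ℕ} {Q P R : Trm}
    (h : subst x (n + 1) (lift Q) P = lift R) :
    ∃ P', P = lift P' ∧ subst x n Q P' = R := by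
  induction P generalizing R with
  | var y m =>
    rw [subst] at h
    split at h
    · rename_i hy
      exact ⟨var x n, by simp [lift, hy], by simpa [subst] using lift_injective h⟩
    · rename_i hy
      obtain ⟨k, rfl, rfl⟩ := lift_eq_var h.symm
      refine ⟨var y k, rfl, ?_⟩
      rw [subst, if_neg]
      simpa using hy
  | app P₁ P₂ ih₁ ih₂ =>
    obtain ⟨R₁, R₂, rfl, h₁, h₂⟩ := lift_eq_app h.symm
    obtain ⟨P₁, rfl, rfl⟩ := ih₁ h₁.symm
    obtain ⟨P₂, rfl, rfl⟩ := ih₂ h₂.symm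
    exact ⟨app P₁ P₂, rfl, rfl⟩
  | lam y m P ih =>
    rw [subst] at h
    split at h
    · rename_i hy
      obtain ⟨k, R', rfl, rfl, rfl⟩ := lift_eq_lam h.symm
      refine ⟨lam y k R', rfl, ?_⟩
      rw [subst, if_pos]
      simpa using hy
    · rename_i hy
      obtain ⟨k, R', rfl, rfl, h'⟩ := lift_eq_lam h.symm
      obtain ⟨P', rfl, rfl⟩ := ih h'.symm
      refine ⟨lam y k P', rfl, ?_⟩
      rw [subst, if_neg]
      simpa using hy

theorem Beta.exists_eq_lift {M N R : Trm} (h : Beta M N) (hR : N = lift R) :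
    ∃ M', M = lift M' ∧ Beta M' R := by
  induction h generalizing R with
  | @redex x n P Q hx hd hc =>
    obtain ⟨Q, rfl⟩ := exists_eq_lift_of_subst_eq_lift hx hR
    rw [deg_lift] at hd
    subst hd
    obtain ⟨P, rfl, rfl⟩ := exists_eq_lift_of_subst_lift_eq_lift hR
    refine ⟨Trm.app (Trm.lam x (Trm.deg Q) P) Q, rfl, .redex (mem_FV_lift.1 hx) rfl fun y m hy => ?_⟩
    rw [← BV_lift]
    exact hc y (m + 1) (mem_FV_lift.2 hy)
  | lam _ h₁ h₂ ih =>
    obtain ⟨k, R', rfl, rfl, rfl⟩ := lift_eq_lam hR.symm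
    obtain ⟨M', rfl, h⟩ := ih rfl
    exact ⟨_, rfl, .lam h (mem_FV_lift.1 h₁) (mem_FV_lift.1 h₂)⟩
  | appL _ h₁ h₂ ih =>
    obtain ⟨R₁, R₂, rfl, rfl, rfl⟩ := lift_eq_app hR.symm
    obtain ⟨M', rfl, h⟩ := ih rfl
    exact ⟨_, rfl, .appL h (joinable_lift.1 h₁) (joinable_lift.1 h₂)⟩
  | appR _ h₁ h₂ ih =>
    obtain ⟨R₁, R₂, rfl, rfl, rfl⟩ := lift_eq_app hR.symm
    obtain ⟨M', rfl, h⟩ := ih rfl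
    exact ⟨_, rfl, .appR h (joinable_lift.1 h₁) (joinable_lift.1 h₂)⟩

end Trm

namespace Der2

variable {E : Type}

theorem eq_none_iff {M : Trm} {Γ : Env E} {U : Ty E} (h : Der2 M Γ U) (p : Vr × ℕ) :
    Γ p = none ↔ p ∉ Trm.FV M := by
  induction h generalizing p with
  | ax x _ _ => simp [Env.single, Trm.FV]
  | @arrI Γ x n M U T _ _ hx _ ih =>
    have := ih p
    by_cases hp : p = (x, n)
    · subst hp; simp [hx, Trm.FV]
    · simpa [Env.update, hp, Trm.FV] using this
  | arrE _ _ _ _ _ ih₁ ih₂ => simp [Env.inter_eq_none, ih₁, ih₂, Trm.FV]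
  | inter _ _ ih₁ ih₂ => simp [Env.inter_eq_none, ih₁, ih₂]
  | exp e _ ih =>
    obtain ⟨x, _ | n⟩ := p
    · simp [Env.eexp, Trm.not_mem_FV_lift_zero]
    · simp [Env.eexp, ih, Trm.mem_FV_lift]
  | sub _ _ hle ih => rw [hle.1, ih]

theorem good {M : Trm} {Γ : Env E} {U : Ty E} (h : Der2 M Γ U) :
    (Ty.GoodTy U ∧ Ty.deg U = Trm.deg M) ∧
      ∀ p V, Γ p = some V → Ty.GoodTy V ∧ Ty.deg V = p.2 := by
  have env_inter {Γ₁ Γ₂ : Env E} (h₁ : ∀ p V, Γ₁ p = some V → Ty.GoodTy V ∧ Ty.deg V = p.2)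
      (h₂ : ∀ p V, Γ₂ p = some V → Ty.GoodTy V ∧ Ty.deg V = p.2) (p : Vr × ℕ) (V : Ty E)
      (hV : Env.inter Γ₁ Γ₂ p = some V) : Ty.GoodTy V ∧ Ty.deg V = p.2 := by
    have a₁ := h₁ p
    have a₂ := h₂ p
    unfold Env.inter at hV
    grind [Ty.goodTy_inter, Ty.deg]
  induction h with
  | ax x hT hG =>
    refine ⟨⟨hG, hT.deg_eq_zero⟩, fun p V hV => ?_⟩
    have := hT.deg_eq_zero
    grind [Env.single]
  | @arrI Γ x n M U T hU hT hx _ ih =>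
    obtain ⟨⟨h₁, h₂⟩, h₃⟩ := ih
    have hd := hT.deg_eq_zero
    refine ⟨⟨.arr (h₃ (x, n) U (by simp [Env.update])).1 h₁ (by omega), ?_⟩, fun p V hV => ?_⟩
    · simp only [Ty.deg, Trm.deg]
      omega
    · refine h₃ p V ?_
      grind [Env.update]
  | arrE hU hT _ _ _ ih₁ ih₂ =>
    have hd := hT.deg_eq_zero
    refine ⟨⟨(Ty.goodTy_arr.1 ih₁.1.1).2.1, ?_⟩, env_inter ih₁.2 ih₂.2⟩
    have := ih₁.1.2
    simp only [Ty.deg, Trm.deg] at this ⊢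
    omega
  | inter _ _ ih₁ ih₂ =>
    refine ⟨⟨.inter ih₁.1.1 ih₂.1.1 (ih₁.1.2.trans ih₂.1.2.symm), ?_⟩, env_inter ih₁.2 ih₂.2⟩
    simp [Ty.deg, ih₁.1.2, ih₂.1.2]
  | exp e _ ih =>
    refine ⟨⟨.exp e ih.1.1, by simp [Ty.deg, Trm.deg_lift, ih.1.2]⟩, ?_⟩
    rintro ⟨x, _ | n⟩ V hV
    · simp [Env.eexp] at hV
    · simp only [Env.eexp, Option.map_eq_some_iff] at hV
      obtain ⟨W, hW, rfl⟩ := hV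
      obtain ⟨h₁, h₂⟩ := ih.2 _ _ hW
      exact ⟨.exp e h₁, by simp [Ty.deg, h₂]⟩
  | @sub Γ Γ' M U U' _ hs hle ih =>
    obtain ⟨h₁, h₂⟩ := hs.deg_eq_and_good_iff
    refine ⟨⟨h₂.1 ih.1.1, h₁ ▸ ih.1.2⟩, fun p V hV => ?_⟩
    cases hW : Γ p with
    | none => simp [(hle.1 p).2 hW] at hV
    | some W =>
      obtain ⟨h₃, h₄⟩ := (hle.2 p V W hV hW).deg_eq_and_good_iff
      obtain ⟨h₅, h₆⟩ := ih.2 p W hW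
      exact ⟨h₄.2 h₅, h₃.trans h₆⟩

theorem of_env_le {M : Trm} {Γ Γ' : Env E} {U : Ty E} (h : Der2 M Γ U) (hle : Env.LE Γ' Γ) :
    Der2 M Γ' U :=
  h.sub (.ofEq (.refl _)) hle

theorem env_joinable {M N : Trm} {Γ Δ : Env E} {U V : Ty E} (hM : Der2 M Γ U) (hN : Der2 N Δ V)
    (h : Trm.Joinable M N) : Env.Joinable Γ Δ := by
  intro x m n hm hn
  refine h x m n ?_ ?_
  · by_contra hc
    exact hm ((hM.eq_none_iff _).2 hc)
  · by_contra hc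
    exact hn ((hN.eq_none_iff _).2 hc)

/-- The typing of `P[x^n := Q]` with `Γ` and `U` splits into a typing of `P`, in which `x^n`
gets a restricted type, and a typing of `Q` with that type. -/
def Splits (P : Trm) (x : Vr) (n : ℕ) (Q : Trm) (Γ : Env E) (U : Ty E) : Prop :=
  ∃ (V : Ty E) (Γ₁ Γ₂ : Env E), Ty.IsU V ∧ Γ₁ (x, n) = none ∧
    Der2 P (Env.update Γ₁ (x, n) V) U ∧ Der2 Q Γ₂ V ∧ Env.LE Γ (Env.inter Γ₁ Γ₂)

theorem splits_var {Q : Trm} {Γ : Env E} {T : Ty E} (h : Der2 Q Γ T) (hT : Ty.IsT T)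
    {x y : Vr} {n m : ℕ} (hx : (x, n) ∈ Trm.FV (Trm.var y m)) (hd : Trm.deg Q = n) :
    Splits (.var y m) x n Q Γ T := by
  obtain ⟨rfl, rfl⟩ : x = y ∧ n = m := by simpa [Trm.FV] using hx
  obtain rfl : n = 0 := by rw [← hd, ← h.good.1.2, hT.deg_eq_zero]
  exact ⟨T, Env.empty, Γ, .ofT hT, rfl, .ax x hT h.good.1.1, h, Env.le_refl _⟩

/-- The side conditions under which `P[x^n := Q]` is a contraction inside 𝓜. -/
structure Contractible (P : Trm) (x : Vr) (n : ℕ) (Q : Trm) : Prop where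
  inM : Trm.InM P
  mem : (x, n) ∈ Trm.FV P
  deg : Trm.deg Q = n
  notCaptured : ∀ y m, (y, m) ∈ Trm.FV Q → y ∉ Trm.BV P

theorem splits {R : Trm} {Γ : Env E} {U : Ty E} (h : Der2 R Γ U) {P Q : Trm} {x : Vr} {n : ℕ}
    (hR : R = Trm.subst x n Q P) (hP : Contractible P x n Q) : Splits P x n Q Γ U := by
  induction h generalizing P Q n with
  | ax z hT hG =>
    cases P with
    | var y m =>
      obtain ⟨rfl, rfl⟩ : x = y ∧ n = m := by simpa [Trm.FV] using hP.mem
      simp only [Trm.subst, and_self, if_true] at hR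
      subst hR
      exact splits_var (.ax z hT hG) hT hP.mem hP.deg
    | app P₁ P₂ => simp [Trm.subst] at hR
    | lam y m P => rw [Trm.subst] at hR; split at hR <;> cases hR
  | @arrI Γ z k M W T hW hT hz hM ih =>
    cases P with
    | var y m =>
      obtain ⟨rfl, rfl⟩ : x = y ∧ n = m := by simpa [Trm.FV] using hP.mem
      simp only [Trm.subst, and_self, if_true] at hR
      subst hR
      exact splits_var (.arrI hW hT hz hM) (.arr hW hT) hP.mem hP.deg
    | app P₁ P₂ => simp [Trm.subst] at hR
    | lam y m P =>
      obtain ⟨hPM, hx, hd, hc⟩ := hP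
      have hne : (y, m) ≠ (x, n) := fun h => hx.2 h.symm
      rw [Trm.subst, if_neg (by simpa using hne)] at hR
      obtain ⟨rfl, rfl, rfl⟩ := Trm.lam.inj hR
      obtain ⟨V, Γ₁, Γ₂, hV, h₁, h₂, h₃, hle⟩ := ih rfl
        ⟨(Trm.inM_lam.1 hPM).1, hx.1, hd, fun y m hy hb => hc y m hy (.inr hb)⟩
      have hy₂ : Γ₂ (z, k) = none := (h₃.eq_none_iff _).2 fun hb => hc z k hb (.inl rfl)
      refine ⟨V, fun q => if q = (z, k) then none else Γ₁ q, Γ₂, hV, by simp [h₁], ?_, h₃, ?_, ?_⟩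
      · refine .arrI hW hT (by simp [Env.update, hne]) (h₂.of_env_le ⟨fun q => ?_, fun q A B => ?_⟩)
        · have := hle.1 q
          rw [Env.inter_eq_none] at this
          grind [Env.update]
        · have := hle.2 q A B
          by_cases hq : q = (z, k)
          · subst hq
            simp only [Env.update, Env.inter, hy₂, hne, if_true, if_false] at this ⊢
            intro hA hB
            exact this hA (by rw [hB])
          · simp only [Env.update, hq, if_false]
            intro hA hB
            rw [hA] at hB
            cases hB
            exact .ofEq (.refl _)
      · intro q
        have := hle.1 q
        rw [Env.inter_eq_none] at this ⊢
        grind [Env.update]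
      · intro q A B hA hB
        have hq : q ≠ (z, k) := by rintro rfl; simp [hz] at hA
        refine hle.2 q A B (by simpa [Env.update, hq] using hA) ?_
        simpa [Env.inter, hq] using hB
  | @arrE Γ₁ Γ₂ M₁ M₂ W T hW hT h₁ h₂ hj ih₁ ih₂ =>
    cases P with
    | var y m =>
      obtain ⟨rfl, rfl⟩ : x = y ∧ n = m := by simpa [Trm.FV] using hP.mem
      simp only [Trm.subst, and_self, if_true] at hR
      subst hR
      exact splits_var (.arrE hW hT h₁ h₂ hj) hT hP.mem hP.deg
    | lam y m P => rw [Trm.subst] at hR; split at hR <;> cases hR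
    | app P₁ P₂ =>
      obtain ⟨hPM, hx, hd, hc⟩ := hP
      obtain ⟨hP₁, hP₂, hP₁₂⟩ := Trm.inM_app.1 hPM
      obtain ⟨rfl, rfl⟩ := Trm.app.inj hR
      have hc₁ : ∀ y m, (y, m) ∈ Trm.FV Q → y ∉ Trm.BV P₁ := fun y m hy hb =>
        hc y m hy (.inl hb)
      have hc₂ : ∀ y m, (y, m) ∈ Trm.FV Q → y ∉ Trm.BV P₂ := fun y m hy hb =>
        hc y m hy (.inr hb)
      by_cases hx₁ : (x, n) ∈ Trm.FV P₁ <;> by_cases hx₂ : (x, n) ∈ Trm.FV P₂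
      · obtain ⟨V, A₁, A₂, hV, a₁, a₂, a₃, a₄⟩ := ih₁ rfl ⟨hP₁, hx₁, hd, hc₁⟩
        obtain ⟨V', B₁, B₂, hV', b₁, b₂, b₃, b₄⟩ := ih₂ rfl ⟨hP₂, hx₂, hd, hc₂⟩
        refine ⟨.inter V V', A₁.inter B₁, A₂.inter B₂, .inter hV hV',
          Env.inter_eq_none.2 ⟨a₁, b₁⟩, ?_, .inter a₃ b₃,
          Env.le_trans (Env.inter_le_inter a₄ b₄) (Env.inter_inter_inter_le _ _ _ _)⟩
        rw [← Env.update_inter_update]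
        exact .arrE hW hT a₂ b₂ (a₂.env_joinable b₂ hP₁₂)
      · obtain ⟨V, A₁, A₂, hV, a₁, a₂, a₃, a₄⟩ := ih₁ rfl ⟨hP₁, hx₁, hd, hc₁⟩
        rw [Trm.subst_eq_self hx₂] at h₂
        have hn := (h₂.eq_none_iff _).2 hx₂
        refine ⟨V, A₁.inter Γ₂, A₂, hV, Env.inter_eq_none.2 ⟨a₁, hn⟩, ?_, a₃, ?_⟩
        · rw [← Env.update_inter _ _ hn]
          exact .arrE hW hT a₂ h₂ (a₂.env_joinable h₂ hP₁₂)
        · have := Env.inter_inter_inter_le A₁ A₂ Γ₂ Env.empty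
          rw [Env.inter_empty, Env.inter_empty] at this
          exact Env.le_trans (Env.inter_le_inter a₄ (Env.le_refl _)) this
      · obtain ⟨V, B₁, B₂, hV, b₁, b₂, b₃, b₄⟩ := ih₂ rfl ⟨hP₂, hx₂, hd, hc₂⟩
        rw [Trm.subst_eq_self hx₁] at h₁
        have hn := (h₁.eq_none_iff _).2 hx₁
        refine ⟨V, Γ₁.inter B₁, B₂, hV, Env.inter_eq_none.2 ⟨hn, b₁⟩, ?_, b₃, ?_⟩
        · rw [← Env.inter_update _ _ hn]
          exact .arrE hW hT h₁ b₂ (h₁.env_joinable b₂ hP₁₂)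
        · have := Env.inter_inter_inter_le Γ₁ Env.empty B₁ B₂
          rw [Env.inter_empty, Env.empty_inter] at this
          exact Env.le_trans (Env.inter_le_inter (Env.le_refl _) b₄) this
      · exact (hx.elim hx₁ hx₂).elim
  | inter _ _ ih₁ ih₂ =>
    obtain ⟨V, A₁, A₂, hV, a₁, a₂, a₃, a₄⟩ := ih₁ hR hP
    obtain ⟨V', B₁, B₂, hV', b₁, b₂, b₃, b₄⟩ := ih₂ hR hP
    refine ⟨.inter V V', A₁.inter B₁, A₂.inter B₂, .inter hV hV',
      Env.inter_eq_none.2 ⟨a₁, b₁⟩, ?_, .inter a₃ b₃,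
      Env.le_trans (Env.inter_le_inter a₄ b₄) (Env.inter_inter_inter_le _ _ _ _)⟩
    rw [← Env.update_inter_update]
    exact .inter a₂ b₂
  | exp e _ ih =>
    obtain ⟨hPM, hx, hd, hc⟩ := hP
    obtain ⟨Q, rfl⟩ := Trm.exists_eq_lift_of_subst_eq_lift hx hR.symm
    rw [Trm.deg_lift] at hd
    subst hd
    obtain ⟨P, rfl, hR'⟩ := Trm.exists_eq_lift_of_subst_lift_eq_lift hR.symm
    obtain ⟨V, A₁, A₂, hV, a₁, a₂, a₃, a₄⟩ := ih hR'.symm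
      ⟨Trm.inM_lift.1 hPM, Trm.mem_FV_lift.1 hx, rfl, fun y m hy =>
        Trm.BV_lift P ▸ hc y (m + 1) (Trm.mem_FV_lift.2 hy)⟩
    refine ⟨.exp e V, A₁.eexp e, A₂.eexp e, .exp e hV, by simp [Env.eexp, a₁], ?_, .exp e a₃,
      Env.le_trans (Env.eexp_le_eexp e a₄) (Env.eexp_inter_le _ _ _)⟩
    rw [← Env.eexp_update]
    exact .exp e a₂
  | sub _ hs hle ih =>
    obtain ⟨V, A₁, A₂, hV, a₁, a₂, a₃, a₄⟩ := ih hR hP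
    exact ⟨V, A₁, A₂, hV, a₁, a₂.sub hs (Env.le_refl _), a₃, Env.le_trans hle a₄⟩

theorem redex_of_isT {P Q : Trm} {x : Vr} {n : ℕ} {Γ : Env E} {T : Ty E}
    (h : Der2 (Trm.subst x n Q P) Γ T) (hT : Ty.IsT T)
    (hM : Trm.InM (.app (.lam x n P) Q)) (hd : Trm.deg Q = n)
    (hc : ∀ y m, (y, m) ∈ Trm.FV Q → y ∉ Trm.BV P) : Der2 (.app (.lam x n P) Q) Γ T := by
  obtain ⟨h₁, _, hj⟩ := Trm.inM_app.1 hM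
  obtain ⟨hP, hx⟩ := Trm.inM_lam.1 h₁
  obtain ⟨V, Γ₁, Γ₂, hV, hn, dP, dQ, hle⟩ := h.splits rfl ⟨hP, hx, hd, hc⟩
  have dL : Der2 (.lam x n P) Γ₁ (.arr V T) := .arrI hV hT hn dP
  exact (Der2.arrE hV hT dL dQ (dL.env_joinable dQ hj)).of_env_le hle

theorem of_beta {M N : Trm} {Γ : Env E} {U : Ty E} (h : Der2 N Γ U) (hM : Trm.InM M)
    (r : Trm.Beta M N) : Der2 M Γ U := by
  induction h generalizing M with
  | ax x hT hG =>
    generalize hN : Trm.var x 0 = N at r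
    cases r with
    | redex _ hd hc => exact redex_of_isT (hN ▸ .ax x hT hG) hT hM hd hc
    | _ => cases hN
  | @arrI Γ x n N U T hU hT hx h ih =>
    generalize hN : Trm.lam x n N = N' at r
    cases r with
    | redex _ hd hc => exact redex_of_isT (hN ▸ .arrI hU hT hx h) (.arr hU hT) hM hd hc
    | lam r _ _ =>
      cases hN
      exact .arrI hU hT hx (ih (Trm.inM_lam.1 hM).1 r)
    | _ => cases hN
  | @arrE Γ₁ Γ₂ N₁ N₂ U T hU hT h₁ h₂ hj ih₁ ih₂ =>
    generalize hN : Trm.app N₁ N₂ = N at r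
    cases r with
    | redex _ hd hc => exact redex_of_isT (hN ▸ .arrE hU hT h₁ h₂ hj) hT hM hd hc
    | appL r _ _ =>
      cases hN
      exact .arrE hU hT (ih₁ (Trm.inM_app.1 hM).1 r) h₂ hj
    | appR r _ _ =>
      cases hN
      exact .arrE hU hT h₁ (ih₂ (Trm.inM_app.1 hM).2.1 r) hj
    | _ => cases hN
  | inter _ _ ih₁ ih₂ => exact .inter (ih₁ hM r) (ih₂ hM r)
  | exp e _ ih =>
    obtain ⟨M, rfl, r'⟩ := r.exists_eq_lift rfl
    exact .exp e (ih (Trm.inM_lift.1 hM) r')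
  | sub _ hs hle ih => exact (ih hM r).sub hs hle

end Der2

/-- subject expansion for β in ⊢2: if `N : ⟨Γ ⊢2 U⟩` is derivable,
`M ∈ 𝓜` and `M ▷β* N`, then `M : ⟨Γ ⊢2 U⟩` is derivable. -/
theorem subject_expansion_der2 {E : Type} (M N : Trm) (Γ : Env E) (U : Ty E)
    (h : Der2 N Γ U) (hM : Trm.InM M) (r : Trm.Betas M N) : Der2 M Γ U := by
  induction r using Relation.ReflTransGen.head_induction_on with
  | refl => exact h
  | head r _ ih => exact (ih (r.inM hM)).of_beta hM r
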